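/- Let γ, L, Δ > 0, α, β > 0 with α + β > 1, set ω := 1 + (β−1)/α, and define C_1 := L·Δ² / (2(α+β−1)), C_2 := L·Δ²·Γ(ω) / (2α·(2γL)^ω). Suppose γL ∈ (0,1), λ_i = γL·i^{−α}, w_i = (LΔ²/2)·i^{−(α+β)}, and let the width-d excess loss after k steps be E(k,d) := Σ_{i>d} w_i + Σ_{i=1}^d w_i (1 − λ_i)^{2k}. If d : ℕ → ℕ satisfies d(k) → ∞, k / d(k)^α → 0, and k^{ω}·d(k)^{−(α+β−1)} converges to a finite limit μ ≥ 0, then E(k, d(k)) − C_1·d(k)^{−(α+β−1)} − C_2·k^{−ω} = o(d(k)^{−(α+β−1)} + k^{−ω}) as k → ∞. -/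

import Mathlib

open Filter Asymptotics

/-- A finite sum over `1, …, n` as the integral of the step function `x ↦ F ⌈x⌉₊`. -/
theorem intervalIntegrable_and_integral_natCeil (F : ℕ → ℝ) (n : ℕ) :
    IntervalIntegrable (fun x : ℝ => F ⌈x⌉₊) MeasureTheory.volume 0 n ∧
      ∫ x in (0 : ℝ)..n, F ⌈x⌉₊ = ∑ i ∈ Finset.Icc 1 n, F i := by
  induction n with
  | zero => simp
  | succ n ih =>
    have hle : (n : ℝ) ≤ ((n + 1 : ℕ) : ℝ) := by push_cast; linarith
    have hceil : Set.EqOn (fun _ : ℝ => F (n + 1)) (fun x : ℝ => F ⌈x⌉₊)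
        (Set.uIoc (n : ℝ) ((n + 1 : ℕ) : ℝ)) := by
      intro x hx
      rw [Set.uIoc_of_le hle] at hx
      have : ⌈x⌉₊ = n + 1 := by
        rw [Nat.ceil_eq_iff (by omega)]
        exact ⟨by simpa using hx.1, hx.2⟩
      simp [this]
    have hint : IntervalIntegrable (fun x : ℝ => F ⌈x⌉₊) MeasureTheory.volume n
        ((n + 1 : ℕ) : ℝ) :=
      (intervalIntegrable_const (c := F (n + 1))).congr hceil
    refine ⟨ih.1.trans hint, ?_⟩
    rw [← intervalIntegral.integral_add_adjacent_intervals ih.1 hint, ih.2,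
      Finset.sum_Icc_succ_top (by omega),
      ← intervalIntegral.integral_congr_ae (Eventually.of_forall fun x hx => hceil hx)]
    simp

theorem rpow_mul_exp_neg_mul_le {u p b : ℝ} (hu : 0 ≤ u) (hp : 0 < p) (hb : 0 < b) :
    u ^ p * Real.exp (-(b * u)) ≤ (p / b) ^ p := by
  have h1 : u * b / p ≤ Real.exp (u * b / p) := by
    linarith [Real.add_one_le_exp (u * b / p)]
  have h2 : (u * b / p) ^ p ≤ Real.exp (b * u) := by
    calc (u * b / p) ^ p ≤ Real.exp (u * b / p) ^ p :=
          Real.rpow_le_rpow (by positivity) h1 hp.le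
      _ = Real.exp (b * u) := by
          rw [← Real.exp_mul]; congr 1; field_simp
  have h3 : u ^ p = (p / b) ^ p * (u * b / p) ^ p := by
    rw [← Real.mul_rpow (by positivity) (by positivity)]
    congr 1; field_simp
  rw [h3, mul_assoc]
  refine mul_le_of_le_one_right (by positivity) ?_
  calc _ ≤ Real.exp (b * u) * Real.exp (-(b * u)) := by gcongr
    _ = 1 := by rw [← Real.exp_add]; simp

theorem integral_rpow_mul_exp_neg_mul_rpow_neg {α s b : ℝ} (hα : 0 < α) (hs : 0 < s)
    (hb : 0 < b) :
    ∫ x in Set.Ioi (0 : ℝ), x ^ (-(s + 1)) * Real.exp (-(b * x ^ (-α))) =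
      Real.Gamma (s / α) / (α * b ^ (s / α)) := by
  have h := MeasureTheory.integral_comp_rpow_Ioi
    (fun y : ℝ => y ^ (s / α - 1) * Real.exp (-(b * y))) (p := -α) (by linarith)
  rw [Real.integral_rpow_mul_exp_neg_mul_Ioi (by positivity) hb] at h
  have h2 : ∫ x in Set.Ioi (0 : ℝ), (|-α| * x ^ (-α - 1)) •
      ((x ^ (-α)) ^ (s / α - 1) * Real.exp (-(b * x ^ (-α)))) =
      α * ∫ x in Set.Ioi (0 : ℝ), x ^ (-(s + 1)) * Real.exp (-(b * x ^ (-α))) := by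
    rw [← MeasureTheory.integral_const_mul]
    refine MeasureTheory.setIntegral_congr_fun measurableSet_Ioi fun x hx => ?_
    have hx : 0 < x := hx
    have e : x ^ (-(s + 1)) = x ^ (-α - 1) * (x ^ (-α)) ^ (s / α - 1) := by
      rw [← Real.rpow_mul hx.le, ← Real.rpow_add hx]
      congr 1; field_simp; ring
    simp only [abs_neg, abs_of_pos hα, smul_eq_mul, e]
    ring
  rw [h2] at h
  rw [Real.div_rpow zero_le_one hb.le, Real.one_rpow] at h
  have : 0 < b ^ (s / α) := by positivity
  field_simp at h ⊢
  linarith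

theorem tsum_rpow_tail_le {s : ℝ} (hs : 0 < s) {d : ℕ} (hd : 1 ≤ d) :
    ∑' i : {i : ℕ // d < i}, ((i : ℕ) : ℝ) ^ (-(s + 1)) ≤ (d : ℝ) ^ (-s) / s := by
  have hd0 : (0 : ℝ) < d := by exact_mod_cast hd
  refine Real.tsum_le_of_sum_le (fun i => by positivity) fun t => ?_
  obtain ⟨N, hdN, hN⟩ : ∃ N, d ≤ N ∧ ∀ i ∈ t, (i : ℕ) ≤ N :=
    ⟨d + t.sup (fun i => (i : ℕ)), by omega, fun i hi =>
      (Finset.le_sup (f := fun i : {i : ℕ // d < i} => (i : ℕ)) hi).trans (by omega)⟩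
  have hdN' : (d : ℝ) ≤ N := by exact_mod_cast hdN
  calc ∑ i ∈ t, ((i : ℕ) : ℝ) ^ (-(s + 1))
      = ∑ j ∈ t.map (Function.Embedding.subtype _), (j : ℝ) ^ (-(s + 1)) := by
        simp
    _ ≤ ∑ j ∈ Finset.Ico (d + 1) (N + 1), (j : ℝ) ^ (-(s + 1)) := by
        refine Finset.sum_le_sum_of_subset_of_nonneg (fun j hj => ?_)
          fun _ _ _ => by positivity
        simp only [Finset.mem_map, Function.Embedding.subtype_apply] at hj
        obtain ⟨i, hi, rfl⟩ := hj
        have := hN i hi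
        have := i.2
        simp only [Finset.mem_Ico]
        omega
    _ = ∑ j ∈ Finset.Ico d N, ((j + 1 : ℕ) : ℝ) ^ (-(s + 1)) := by
        rw [Finset.sum_Ico_add' (fun j : ℕ => (j : ℝ) ^ (-(s + 1)))]
    _ ≤ ∫ x in (d : ℝ)..N, x ^ (-(s + 1)) := by
        refine AntitoneOn.sum_le_integral_Ico (f := fun x : ℝ => x ^ (-(s + 1))) hdN ?_
        intro x hx y hy hxy
        exact Real.rpow_le_rpow_of_nonpos (hd0.trans_le hx.1) hxy (by linarith)
    _ = ((d : ℝ) ^ (-s) - (N : ℝ) ^ (-s)) / s := by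
        rw [integral_rpow]
        · rw [show -(s + 1) + 1 = -s by ring]
          field_simp
          ring
        · right
          refine ⟨by linarith, ?_⟩
          rw [Set.uIcc_of_le hdN']
          exact fun h => absurd h.1 (not_le.mpr hd0)
    _ ≤ (d : ℝ) ^ (-s) / s := by
        gcongr
        have : 0 ≤ (N : ℝ) ^ (-s) := by positivity
        linarith

/-- The scaling limit of the truncated spectral sum, by dominated convergence after the
substitution `i = k ^ (1 / α) * x`. -/
theorem tendsto_rpow_mul_sum_rpow_mul_one_sub_pow {α s a : ℝ} (hα : 0 < α) (hs : 0 < s)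
    (ha : 0 < a) (ha1 : a ≤ 1) {d : ℕ → ℕ}
    (hd : Tendsto (fun k : ℕ => (d k : ℝ) / (k : ℝ) ^ (1 / α)) atTop atTop) :
    Tendsto (fun k : ℕ => (k : ℝ) ^ (s / α) * ∑ i ∈ Finset.Icc 1 (d k),
        (i : ℝ) ^ (-(s + 1)) * (1 - a * (i : ℝ) ^ (-α)) ^ (2 * k)) atTop
      (nhds (Real.Gamma (s / α) / (α * (2 * a) ^ (s / α)))) := by
  rw [← integral_rpow_mul_exp_neg_mul_rpow_neg hα hs (by positivity : 0 < 2 * a)]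
  set K : ℕ → ℝ := fun k => (k : ℝ) ^ (1 / α) with hK
  set F : ℕ → ℕ → ℝ := fun k i => (i : ℝ) ^ (-(s + 1)) * (1 - a * (i : ℝ) ^ (-α)) ^ (2 * k)
    with hF
  set G : ℕ → ℝ → ℝ := fun k => (Set.Ioc 0 (d k / K k)).indicator
    (fun x => K k ^ (s + 1) * F k ⌈K k * x⌉₊) with hG
  have hKpos : ∀ k : ℕ, 1 ≤ k → 0 < K k := fun k hk => by
    have : (0 : ℝ) < k := by exact_mod_cast hk
    positivity
  have hKα : ∀ k : ℕ, K k ^ α = k := fun k => by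
    simp only [hK]
    rw [← Real.rpow_mul (by positivity), one_div_mul_cancel hα.ne', Real.rpow_one]
  have hKtop : Tendsto K atTop atTop :=
    (tendsto_rpow_atTop (by positivity : 0 < 1 / α)).comp tendsto_natCast_atTop_atTop
  have hmul_rpow : ∀ k m : ℕ, 1 ≤ k →
      (k : ℝ) * (m : ℝ) ^ (-α) = ((m : ℝ) / K k) ^ (-α) := fun k m hk => by
    have := hKpos k hk
    rw [Real.div_rpow (by positivity) this.le, Real.rpow_neg this.le, hKα, div_inv_eq_mul,
      mul_comm]
  have hscale : ∀ k m : ℕ, 1 ≤ k →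
      K k ^ (s + 1) * (m : ℝ) ^ (-(s + 1)) = ((m : ℝ) / K k) ^ (-(s + 1)) := fun k m hk => by
    have := hKpos k hk
    rw [Real.div_rpow (by positivity) this.le, Real.rpow_neg this.le (s + 1), div_inv_eq_mul,
      mul_comm]
  have hrepr : ∀ k : ℕ, 1 ≤ k →
      ∫ x in Set.Ioi (0 : ℝ), G k x = (k : ℝ) ^ (s / α) * ∑ i ∈ Finset.Icc 1 (d k), F k i := by
    intro k hk
    have hk0 := hKpos k hk
    have h0 : 0 ≤ (d k : ℝ) / K k := by positivity
    rw [MeasureTheory.setIntegral_indicator measurableSet_Ioc,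
      Set.inter_eq_right.mpr Set.Ioc_subset_Ioi_self, ← intervalIntegral.integral_of_le h0,
      intervalIntegral.integral_const_mul,
      intervalIntegral.integral_comp_mul_left (fun x => F k ⌈x⌉₊) hk0.ne', mul_zero,
      mul_div_cancel₀ _ hk0.ne', (intervalIntegrable_and_integral_natCeil (F k) (d k)).2,
      smul_eq_mul, ← mul_assoc, Real.rpow_add_one hk0.ne', mul_assoc (K k ^ s),
      mul_inv_cancel₀ hk0.ne', mul_one]
    congr 1
    simp only [hK]
    rw [← Real.rpow_mul (by positivity)]
    congr 1
    ring
  refine Tendsto.congr' ((eventually_ge_atTop 1).mono hrepr) ?_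
  set M : ℝ := ((s + 1) / α / (2 * a)) ^ ((s + 1) / α) with hM
  refine MeasureTheory.tendsto_integral_filter_of_dominated_convergence
    (fun x => if x ≤ 1 then M else x ^ (-(s + 1))) ?_ ?_ ?_ ?_
  · refine Eventually.of_forall fun k => Measurable.aestronglyMeasurable ?_
    refine Measurable.indicator (Measurable.const_mul ?_ _) measurableSet_Ioc
    exact (measurable_from_nat (f := F k)).comp
      (Nat.measurable_ceil.comp (measurable_const_mul (K k)))
  · filter_upwards [eventually_ge_atTop 1] with k hk
    filter_upwards [MeasureTheory.ae_restrict_mem measurableSet_Ioi] with x hx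
    have hx : 0 < x := hx
    have hk0 := hKpos k hk
    set m := ⌈K k * x⌉₊ with hm
    have hm1 : 1 ≤ m := Nat.one_le_ceil_iff.mpr (by positivity)
    have hm1' : (1 : ℝ) ≤ m := by exact_mod_cast hm1
    set y : ℝ := m / K k with hy
    have hxy : x ≤ y := by
      rw [hy, le_div_iff₀ hk0, mul_comm]
      exact Nat.le_ceil _
    have hy0 : 0 < y := hx.trans_le hxy
    have hbase : 0 ≤ 1 - a * (m : ℝ) ^ (-α) := by
      have : (m : ℝ) ^ (-α) ≤ 1 := Real.rpow_le_one_of_one_le_of_nonpos hm1' (by linarith)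
      have : 0 ≤ (m : ℝ) ^ (-α) := by positivity
      nlinarith
    have hpow : (1 - a * (m : ℝ) ^ (-α)) ^ (2 * k) ≤ Real.exp (-(2 * a * y ^ (-α))) := by
      calc _ ≤ Real.exp (-(a * (m : ℝ) ^ (-α))) ^ (2 * k) := by
            gcongr
            exact Real.one_sub_le_exp_neg _
        _ = _ := by
            rw [← Real.exp_nat_mul, hy, ← hmul_rpow k m hk]
            push_cast
            congr 1
            ring
    have hpow0 : 0 ≤ (1 - a * (m : ℝ) ^ (-α)) ^ (2 * k) := by positivity
    have hval : K k ^ (s + 1) * F k m =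
        y ^ (-(s + 1)) * (1 - a * (m : ℝ) ^ (-α)) ^ (2 * k) := by
      rw [hy, ← hscale k m hk, mul_assoc]
    have hle : K k ^ (s + 1) * F k m ≤ y ^ (-(s + 1)) * Real.exp (-(2 * a * y ^ (-α))) := by
      rw [hval]
      gcongr
    have hnonneg : 0 ≤ K k ^ (s + 1) * F k m := by
      rw [hval]
      positivity
    refine (norm_indicator_le_norm_self _ _).trans ?_
    rw [Real.norm_of_nonneg hnonneg]
    refine hle.trans ?_
    split_ifs with h1
    · have := rpow_mul_exp_neg_mul_le (u := y ^ (-α)) (p := (s + 1) / α) (b := 2 * a)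
        (by positivity) (by positivity) (by positivity)
      rwa [← Real.rpow_mul hy0.le,
        show -α * ((s + 1) / α) = -(s + 1) by field_simp] at this
    · calc _ ≤ y ^ (-(s + 1)) :=
            mul_le_of_le_one_right (by positivity)
              (Real.exp_le_one_iff.mpr (neg_nonpos.mpr (by positivity)))
        _ ≤ x ^ (-(s + 1)) := Real.rpow_le_rpow_of_nonpos hx hxy (by linarith)
  · change MeasureTheory.IntegrableOn _ (Set.Ioi (0 : ℝ)) MeasureTheory.volume
    rw [← Set.Ioc_union_Ioi_eq_Ioi (zero_le_one (α := ℝ))]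
    refine MeasureTheory.IntegrableOn.union ?_ ?_
    · refine (MeasureTheory.integrableOn_const (C := M) (by simp)).congr_fun
        (fun x hx => ?_) measurableSet_Ioc
      simp [hx.2]
    · refine (integrableOn_Ioi_rpow_of_lt (by linarith : -(s + 1) < -1) one_pos).congr_fun
        (fun x hx => ?_) measurableSet_Ioi
      have hx : 1 < x := hx
      simp [hx.not_ge]
  · filter_upwards [MeasureTheory.ae_restrict_mem measurableSet_Ioi] with x hx
    have hx : 0 < x := hx
    have hy : Tendsto (fun k : ℕ => (⌈K k * x⌉₊ : ℝ) / K k) atTop (nhds x) := by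
      have := (tendsto_nat_ceil_mul_div_atTop hx.le).comp hKtop
      simpa only [Function.comp_def, mul_comm x] using this
    have hexp : Tendsto (fun k : ℕ => (1 + -(a * (⌈K k * x⌉₊ : ℝ) ^ (-α))) ^ k) atTop
        (nhds (Real.exp (-(a * x ^ (-α))))) := by
      refine Real.tendsto_one_add_pow_exp_of_tendsto ?_
      refine Tendsto.congr' ?_
        (((hy.rpow_const (p := -α) (Or.inl hx.ne')).const_mul a).neg)
      filter_upwards [eventually_ge_atTop 1] with k hk
      rw [← hmul_rpow k _ hk]
      ring
    have hlim := (hy.rpow_const (p := -(s + 1)) (Or.inl hx.ne')).mul (hexp.pow 2)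
    rw [← Real.exp_nat_mul, show ((2 : ℕ) : ℝ) * -(a * x ^ (-α)) = -(2 * a * x ^ (-α)) by
      push_cast; ring] at hlim
    refine hlim.congr' ?_
    filter_upwards [eventually_ge_atTop 1, hd.eventually_ge_atTop x] with k hk hdk
    have hmem : x ∈ Set.Ioc 0 ((d k : ℝ) / K k) := ⟨hx, hdk⟩
    rw [hG]
    simp only [Set.indicator_of_mem hmem, hF]
    rw [← mul_assoc, hscale k _ hk, ← pow_mul, mul_comm k 2, sub_eq_add_neg]

/-- **exact Phase-1 scaling law.** Under power decay `λ i = γL·i^(-α)`,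
`w i = (LΔ²/2)·i^(-(α+β))` with `γL ∈ (0,1)`, `α + β > 1`, `ω = 1 + (β-1)/α`,
`C₁ = LΔ²/(2(α+β-1))`, `C₂ = LΔ²Γ(ω)/(2α(2γL)^ω)`, and the width-`d` excess loss
`E(k,d) = ∑_{i>d} w i + ∑_{i=1}^d w i (1-λ i)^(2k)`: if `d(k) → ∞`, `k/d(k)^α → 0`, and
`k^ω · d(k)^(-(α+β-1))` converges to a finite limit `μ ≥ 0`, then
`E(k, d(k)) - C₁·d(k)^(-(α+β-1)) - C₂·k^(-ω) = o(d(k)^(-(α+β-1)) + k^(-ω))` as `k → ∞`,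
i.e. `L(θ_k^d) ∼ L* + C₁ d^(-(α+β-1)) + C₂ k^(-ω)`. -/
theorem exact_phase_one_scaling_law
    (γ L Δ α β ω C₁ C₂ : ℝ)
    (hγ : 0 < γ) (hL : 0 < L) (hΔ : 0 < Δ)
    (hγL : γ * L ∈ Set.Ioo (0 : ℝ) 1)
    (hα : 0 < α) (hβ : 0 < β) (hαβ : 1 < α + β)
    (hω : ω = 1 + (β - 1) / α)
    (hC₁ : C₁ = L * Δ ^ 2 / (2 * (α + β - 1)))
    (hC₂ : C₂ = L * Δ ^ 2 * Real.Gamma ω / (2 * α * (2 * γ * L) ^ ω))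
    (lam w : ℕ → ℝ)
    (hlam : ∀ i : ℕ, 1 ≤ i → lam i = γ * L * (i : ℝ) ^ (-α))
    (hw : ∀ i : ℕ, 1 ≤ i → w i = (L * Δ ^ 2 / 2) * (i : ℝ) ^ (-(α + β)))
    (E : ℕ → ℕ → ℝ)
    (hE : ∀ k d : ℕ, E k d =
      (∑' i : {i : ℕ // d < i}, w i) + ∑ i ∈ Finset.Icc 1 d, w i * (1 - lam i) ^ (2 * k))
    (d : ℕ → ℕ)
    (hd : Tendsto d atTop atTop)
    (hund : Tendsto (fun k : ℕ => (k : ℝ) / (d k : ℝ) ^ α) atTop (nhds 0))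
    (μ : ℝ) (hμ : 0 ≤ μ)
    (hlim : Tendsto (fun k : ℕ => (k : ℝ) ^ ω * (d k : ℝ) ^ (-(α + β - 1)))
      atTop (nhds μ)) :
    (fun k : ℕ =>
        E k (d k) - C₁ * (d k : ℝ) ^ (-(α + β - 1)) - C₂ * (k : ℝ) ^ (-ω)) =o[atTop]
      (fun k : ℕ => (d k : ℝ) ^ (-(α + β - 1)) + (k : ℝ) ^ (-ω)) := by
  have hs : 0 < α + β - 1 := by linarith
  obtain ⟨s, hsdef⟩ : ∃ s, s = α + β - 1 := ⟨_, rfl⟩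
  have hωs : ω = s / α := by rw [hω, hsdef]; field_simp; ring
  rw [← hsdef] at hs ⊢
  have hαβs : α + β = s + 1 := by linarith
  have hω0 : 0 < ω := by rw [hωs]; positivity
  have hc : 0 < L * Δ ^ 2 / 2 := by positivity
  have hd1 : ∀ᶠ k in atTop, 1 ≤ d k := hd.eventually_ge_atTop 1
  have hratio : Tendsto (fun k : ℕ => (k : ℝ) ^ ω * (d k : ℝ) ^ (-s)) atTop (nhds 0) := by
    have h := hund.rpow_const (p := ω) (Or.inr hω0.le)
    rw [Real.zero_rpow hω0.ne'] at h
    refine h.congr fun k => ?_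
    rw [Real.div_rpow (by positivity) (by positivity), ← Real.rpow_mul (by positivity),
      Real.rpow_neg (by positivity), div_eq_mul_inv, hωs, mul_div_cancel₀ _ hα.ne']
  have hdK : Tendsto (fun k : ℕ => (d k : ℝ) / (k : ℝ) ^ (1 / α)) atTop atTop := by
    have h := hund.rpow_const (p := 1 / α) (Or.inr (by positivity))
    rw [Real.zero_rpow (by positivity)] at h
    have h' : Tendsto (fun k : ℕ => ((k : ℝ) / (d k : ℝ) ^ α) ^ (1 / α)) atTop
        (nhdsWithin 0 (Set.Ioi 0)) := by
      refine tendsto_nhdsWithin_iff.mpr ⟨h, ?_⟩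
      filter_upwards [hd1, eventually_ge_atTop 1] with k hk hk1
      have : (0 : ℝ) < d k := by exact_mod_cast hk
      have : (0 : ℝ) < k := by exact_mod_cast hk1
      exact Set.mem_Ioi.mpr (by positivity)
    refine h'.inv_tendsto_nhdsGT_zero.congr fun k => ?_
    rw [Pi.inv_apply, Real.div_rpow (by positivity) (by positivity),
      ← Real.rpow_mul (by positivity), mul_one_div_cancel hα.ne', Real.rpow_one, inv_div]
  have hhead := (tendsto_rpow_mul_sum_rpow_mul_one_sub_pow hα hs hγL.1 hγL.2.le hdK).const_mul
    (L * Δ ^ 2 / 2)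
  have htail : Tendsto (fun k : ℕ => (k : ℝ) ^ ω * ∑' i : {i : ℕ // d k < i}, w i) atTop
      (nhds 0) := by
    have hw' : ∀ n : ℕ, ∑' i : {i : ℕ // n < i}, w i =
        (L * Δ ^ 2 / 2) * ∑' i : {i : ℕ // n < i}, ((i : ℕ) : ℝ) ^ (-(s + 1)) := fun n => by
      rw [← tsum_mul_left]
      refine tsum_congr fun i => ?_
      rw [hw i (by have := i.2; omega), hαβs]
    have hub := hratio.const_mul (L * Δ ^ 2 / 2 / s)
    rw [mul_zero] at hub
    refine squeeze_zero' (Eventually.of_forall fun k => ?_) ?_ hub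
    · rw [hw']
      exact mul_nonneg (by positivity) (mul_nonneg hc.le (tsum_nonneg fun i => by positivity))
    · filter_upwards [hd1] with k hk
      rw [hw']
      calc (k : ℝ) ^ ω * (L * Δ ^ 2 / 2 * ∑' i : {i : ℕ // d k < i}, ((i : ℕ) : ℝ) ^ (-(s + 1)))
          ≤ (k : ℝ) ^ ω * (L * Δ ^ 2 / 2 * ((d k : ℝ) ^ (-s) / s)) := by
            gcongr
            exact tsum_rpow_tail_le hs hk
        _ = _ := by ring
  have hC₂' : L * Δ ^ 2 / 2 * (Real.Gamma (s / α) / (α * (2 * (γ * L)) ^ (s / α))) = C₂ := by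
    rw [hC₂, hωs, ← mul_assoc 2 γ L, mul_assoc 2 α, div_mul_div_comm]
  rw [hC₂'] at hhead
  have hzero := ((htail.add hhead).sub (hratio.const_mul C₁)).sub_const C₂
  rw [show (0 : ℝ) + C₂ - C₁ * 0 - C₂ = 0 by ring] at hzero
  have hsmall : (fun k : ℕ =>
      E k (d k) - C₁ * (d k : ℝ) ^ (-s) - C₂ * (k : ℝ) ^ (-ω)) =o[atTop]
      (fun k : ℕ => (k : ℝ) ^ (-ω)) := by
    refine (isLittleO_iff_tendsto' ?_).mpr (hzero.congr' ?_)
    · filter_upwards [eventually_ge_atTop 1] with k hk h0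
      have : (0 : ℝ) < k := by exact_mod_cast hk
      exact absurd h0 (by positivity)
    · filter_upwards [eventually_ge_atTop 1] with k hk
      have hk0 : (0 : ℝ) < k := by exact_mod_cast hk
      have hsum : ∑ i ∈ Finset.Icc 1 (d k), w i * (1 - lam i) ^ (2 * k) =
          L * Δ ^ 2 / 2 * ∑ i ∈ Finset.Icc 1 (d k),
            (i : ℝ) ^ (-(s + 1)) * (1 - γ * L * (i : ℝ) ^ (-α)) ^ (2 * k) := by
        rw [Finset.mul_sum]
        refine Finset.sum_congr rfl fun i hi => ?_
        have hi1 := (Finset.mem_Icc.mp hi).1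
        rw [hw i hi1, hlam i hi1, hαβs, mul_assoc]
      have hinv : (k : ℝ) ^ ω * (k : ℝ) ^ (-ω) = 1 := by
        rw [← Real.rpow_add hk0]; simp
      rw [eq_div_iff (by positivity), hE, hsum, ← hωs]
      linear_combination (∑' i : {i : ℕ // d k < i}, w i + L * Δ ^ 2 / 2 *
        ∑ i ∈ Finset.Icc 1 (d k),
          (i : ℝ) ^ (-(s + 1)) * (1 - γ * L * (i : ℝ) ^ (-α)) ^ (2 * k) -
        C₁ * (d k : ℝ) ^ (-s)) * hinv
  refine hsmall.trans_isBigO (IsBigO.of_bound 1 (Eventually.of_forall fun k => ?_))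
  have h1 : 0 ≤ (k : ℝ) ^ (-ω) := by positivity
  have h2 : 0 ≤ (d k : ℝ) ^ (-s) := by positivity
  rw [Real.norm_of_nonneg h1, Real.norm_of_nonneg (add_nonneg h2 h1)]
  linarith
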